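/- Let k be an algebraically closed field of characteristic zero. Then the Jordan plane k⟨x,y⟩/(xy−yx+x²) is not Morita equivalent to k⟨x,y⟩/(xy−yx+x²−x). -/

import Mathlib

universe u

/-- The free associative algebra `k⟨x,y⟩` on two generators. -/
abbrev FA (k : Type u) [Field k] : Type u := FreeAlgebra k (Fin 2)

/-- The quotient of the free algebra `k⟨x,y⟩` by the two-sided ideal generated by `f`. -/
abbrev AQuot (k : Type u) [Field k] (f : FA k) : Type u :=
  RingQuot (fun a b : FA k => a = f ∧ b = 0)

/-- Two rings are Morita equivalent if their module categories are equivalent. -/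
def IsMorita (A B : Type u) [Ring A] [Ring B] : Prop :=
  Nonempty (ModuleCat.{u} A ≌ ModuleCat.{u} B)

section JordanPlane

open Polynomial

variable {k : Type*} [Field k] {A : Type*} [Ring A] [Algebra k A] {x y : A}

/-- The inner derivation `b ↦ x * b - b * x`. -/
noncomputable def adLin (k : Type*) [Field k] {A : Type*} [Ring A] [Algebra k A] (x : A) :
    Module.End k A :=
  LinearMap.mulLeft k x - LinearMap.mulRight k x

lemma adLin_apply (x b : A) : adLin k x b = x * b - b * x := rfl

lemma adLin_pow_commute_mul {x c : A} (hc : Commute x c) (n : ℕ) (b : A) :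
    (adLin k x ^ n) (c * b) = c * (adLin k x ^ n) b := by
  induction n generalizing b with
  | zero => simp
  | succ n ih =>
    rw [pow_succ, Module.End.mul_apply, Module.End.mul_apply, ← ih]
    congr 1
    rw [adLin_apply, adLin_apply, mul_sub, ← mul_assoc, hc.eq, mul_assoc, mul_assoc]

lemma adLin_pow_succ_mul {x y : A} (hxy : adLin k x (adLin k x y) = 0) (n : ℕ) (b : A) :
    (adLin k x ^ (n + 1)) (y * b) =
      y * (adLin k x ^ (n + 1)) b + (n + 1 : ℕ) • (adLin k x y * (adLin k x ^ n) b) := by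
  have leib (c d : A) : adLin k x (c * d) = adLin k x c * d + c * adLin k x d := by
    simp only [adLin_apply]; noncomm_ring
  induction n with
  | zero => simp [leib, add_comm]
  | succ n ih =>
    rw [pow_succ', Module.End.mul_apply, ih, map_add, map_nsmul, leib, leib, hxy, zero_mul,
      zero_add, ← Module.End.mul_apply, ← pow_succ', ← Module.End.mul_apply, ← pow_succ',
      succ_nsmul _ (n + 1)]
    abel

lemma adLin_pow_apply_pow {x y : A} (hxy : adLin k x (adLin k x y) = 0) (n : ℕ) :
    (adLin k x ^ n) (y ^ n) = n.factorial • (adLin k x y) ^ n ∧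
      (adLin k x ^ (n + 1)) (y ^ n) = 0 := by
  induction n with
  | zero => simp [adLin_apply]
  | succ n ih =>
    constructor
    · rw [pow_succ' y, adLin_pow_succ_mul hxy, ih.1, ih.2, Nat.factorial_succ, mul_zero, zero_add,
        mul_smul_comm, ← pow_succ', mul_smul]
    · rw [pow_succ' y, adLin_pow_succ_mul hxy, pow_succ', Module.End.mul_apply, ih.2]
      simp

lemma adLin_pow_apply_pow_of_lt {x y : A} (hxy : adLin k x (adLin k x y) = 0) {i n : ℕ}
    (h : i < n) : (adLin k x ^ n) (y ^ i) = 0 := by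
  obtain ⟨m, rfl⟩ := Nat.exists_eq_add_of_lt h
  rw [show i + m + 1 = m + (i + 1) by omega, pow_add, Module.End.mul_apply,
    (adLin_pow_apply_pow hxy i).2, map_zero]

lemma commute_aeval_self (x : A) (f : k[X]) : Commute x (aeval x f) := by
  have := Commute.all (X : k[X]) f
  simpa using this.map (aeval x)

lemma mul_aeval_of_jordan (h : y * x = x * y + x ^ 2) (f : k[X]) :
    y * aeval x f = aeval x f * y + x ^ 2 * aeval x (derivative f) := by
  induction f using Polynomial.induction_on with
  | C a => simp [Algebra.commutes]
  | add p q hp hq => simp only [map_add, mul_add, add_mul, hp, hq]; abel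
  | monomial n a ih =>
    have e : (C a * X ^ (n + 1) : k[X]) = C a * X ^ n * X := by ring
    rw [e]
    generalize (C a * X ^ n : k[X]) = g at ih ⊢
    have hc := (commute_aeval_self x g).eq
    rw [map_mul, aeval_X, ← mul_assoc, ih, derivative_mul, derivative_X, mul_one, map_add, map_mul,
      aeval_X, add_mul, mul_assoc _ y x, h, mul_add, mul_add, ← (commute_aeval_self x g).pow_left 2]
    simp only [mul_assoc]
    abel

lemma exists_eval₂_eq (h : y * x = x * y + x ^ 2) (hA : Algebra.adjoin k {x, y} = ⊤) (a : A) :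
    ∃ q : k[X][X], eval₂ (aeval x : k[X] →ₐ[k] A).toRingHom y q = a := by
  have key (f : k[X]) (q : k[X][X]) : eval₂ (aeval x : k[X] →ₐ[k] A).toRingHom y (C f * q) =
      aeval x f * eval₂ (aeval x : k[X] →ₐ[k] A).toRingHom y q := by
    induction q using Polynomial.induction_on' with
    | add p q hp hq => rw [mul_add, eval₂_add, eval₂_add, hp, hq, mul_add]
    | monomial n c => simp [C_mul_monomial, eval₂_monomial, mul_assoc]
  have hy (q : k[X][X]) : ∃ r : k[X][X], eval₂ (aeval x : k[X] →ₐ[k] A).toRingHom y r =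
      y * eval₂ (aeval x : k[X] →ₐ[k] A).toRingHom y q := by
    induction q using Polynomial.induction_on' with
    | add p q hp hq =>
      obtain ⟨r, hr⟩ := hp
      obtain ⟨s, hs⟩ := hq
      exact ⟨r + s, by rw [eval₂_add, eval₂_add, hr, hs, mul_add]⟩
    | monomial n c =>
      refine ⟨monomial (n + 1) c + monomial n (X ^ 2 * derivative c), ?_⟩
      simp only [eval₂_add, eval₂_monomial, AlgHom.toRingHom_eq_coe, RingHom.coe_coe, map_mul,
        map_pow, aeval_X]
      rw [← mul_assoc y, mul_aeval_of_jordan h, add_mul, pow_succ', mul_assoc, mul_assoc]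
  suffices H : ∀ q : k[X][X], ∃ r : k[X][X], eval₂ (aeval x : k[X] →ₐ[k] A).toRingHom y r =
      a * eval₂ (aeval x : k[X] →ₐ[k] A).toRingHom y q by
    obtain ⟨r, hr⟩ := H 1
    exact ⟨r, by rw [hr, eval₂_one, mul_one]⟩
  have ha : a ∈ Algebra.adjoin k {x, y} := hA ▸ Algebra.mem_top
  induction ha using Algebra.adjoin_induction with
  | mem z hz =>
    obtain rfl | rfl := hz
    · exact fun q => ⟨C X * q, by rw [key, aeval_X]⟩
    · exact hy
  | algebraMap r => exact fun q => ⟨C (C r) * q, by rw [key, aeval_C]⟩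
  | add b c _ _ hb hc =>
    intro q
    obtain ⟨r, hr⟩ := hb q
    obtain ⟨s, hs⟩ := hc q
    exact ⟨r + s, by rw [eval₂_add, hr, hs, add_mul]⟩
  | mul b c _ _ hb hc =>
    intro q
    obtain ⟨r, hr⟩ := hc q
    obtain ⟨s, hs⟩ := hb r
    exact ⟨s, by rw [hs, hr, mul_assoc]⟩

variable [CharZero k]

lemma exists_aeval_mem (h : y * x = x * y + x ^ 2) (hA : Algebra.adjoin k {x, y} = ⊤)
    (I : Ideal A) [I.IsTwoSided] {a : A} (ha : a ∈ I) (ha0 : a ≠ 0) :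
    ∃ f : k[X], f ≠ 0 ∧ aeval x f ∈ I := by
  obtain ⟨q, rfl⟩ := exists_eval₂_eq h hA a
  have hq : q ≠ 0 := by rintro rfl; simp at ha0
  have hD : adLin k x y = aeval x (-X ^ 2 : k[X]) := by
    simp [adLin_apply, h]
  have hDD : adLin k x (adLin k x y) = 0 := by
    rw [hD, adLin_apply, (commute_aeval_self x _).eq, sub_self]
  have hI (n : ℕ) (b : A) (hb : b ∈ I) : (adLin k x ^ n) b ∈ I := by
    induction n with
    | zero => simpa
    | succ n ih =>
      rw [pow_succ', Module.End.mul_apply, adLin_apply]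
      exact I.sub_mem (I.mul_mem_left _ ih) (I.mul_mem_right _ ih)
  have := hI q.natDegree _ ha
  rw [eval₂_eq_sum_range, Finset.sum_range_succ, map_add, map_sum, Finset.sum_eq_zero, zero_add]
    at this
  · refine ⟨q.leadingCoeff * (q.natDegree.factorial • (-X ^ 2) ^ q.natDegree), ?_, ?_⟩
    · refine mul_ne_zero (leadingCoeff_ne_zero.mpr hq) (smul_ne_zero (Nat.factorial_ne_zero _) ?_)
      exact pow_ne_zero _ (neg_ne_zero.mpr (pow_ne_zero _ X_ne_zero))
    · rw [AlgHom.toRingHom_eq_coe, RingHom.coe_coe,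
        adLin_pow_commute_mul (commute_aeval_self x _), (adLin_pow_apply_pow hDD _).1, hD] at this
      simpa using this
  · intro i hi
    rw [AlgHom.toRingHom_eq_coe, RingHom.coe_coe, adLin_pow_commute_mul (commute_aeval_self x _),
      adLin_pow_apply_pow_of_lt hDD (Finset.mem_range.mp hi), mul_zero]

lemma exists_pow_mem (h : y * x = x * y + x ^ 2) (hA : Algebra.adjoin k {x, y} = ⊤)
    (I : Ideal A) [I.IsTwoSided] {a : A} (ha : a ∈ I) (ha0 : a ≠ 0) :
    ∃ n : ℕ, x ^ n ∈ I := by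
  suffices H : ∀ d m : ℕ, ∀ g : k[X], g.natDegree ≤ d → g ≠ 0 → aeval x (X ^ m * g) ∈ I →
      ∃ n : ℕ, x ^ n ∈ I by
    obtain ⟨f, hf0, hf⟩ := exists_aeval_mem h hA I ha ha0
    exact H _ 0 f le_rfl hf0 (by simpa using hf)
  intro d
  induction d with
  | zero =>
    intro m g hg hg0 hI
    rw [eq_C_of_natDegree_le_zero hg] at hg0 hI
    have hc : g.coeff 0 ≠ 0 := by simpa using hg0
    refine ⟨m, ?_⟩
    have := I.mul_mem_left (algebraMap k A (g.coeff 0)⁻¹) hI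
    rwa [map_mul, aeval_C, ← Algebra.commutes, ← mul_assoc, ← map_mul, inv_mul_cancel₀ hc, map_one,
      one_mul, map_pow, aeval_X] at this
  | succ d ih =>
    intro m g hg hg0 hI
    by_cases hd : g.natDegree = 0
    · exact ih m g (by omega) hg0 hI
    refine ih (m + 2) (derivative g) ?_ ?_ ?_
    · have := natDegree_derivative_lt hd
      omega
    · intro h0
      exact hd (derivative_eq_zero.mp h0)
    · have h1 : x ^ 2 * aeval x (derivative (X ^ m * g)) ∈ I := by
        have := I.sub_mem (I.mul_mem_left y hI) (I.mul_mem_right y hI)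
        rwa [mul_aeval_of_jordan h, add_sub_cancel_left] at this
      have h2 := I.mul_mem_left (aeval x ((m : k[X]) * X)) hI
      have h3 := I.sub_mem h1 h2
      have e : x ^ 2 = aeval x (X ^ 2 : k[X]) := by simp
      rw [e, ← map_mul, ← map_mul, ← map_sub] at h3
      convert h3 using 2
      rcases m with _ | m
      · simp
      · rw [derivative_mul, derivative_X_pow]
        simp only [Nat.add_sub_cancel, map_natCast]
        ring

end JordanPlane

section Modules

open Polynomial

variable {k : Type*} [Field k] {A : Type*} [Ring A] [Algebra k A] {x y : A}
  {E : Type*} [AddCommGroup E] [Module A E] [Module k E] [IsScalarTower k A E]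

lemma exists_linearMap_eq_of_commute (hA : Algebra.adjoin k {x, y} = ⊤) (T : E →ₗ[k] E)
    (hx : ∀ e, T (x • e) = x • T e) (hy : ∀ e, T (y • e) = y • T e) :
    ∃ g : E →ₗ[A] E, ∀ e, g e = T e := by
  have H (a : A) : ∀ e, T (a • e) = a • T e := by
    have ha : a ∈ Algebra.adjoin k {x, y} := hA ▸ Algebra.mem_top
    induction ha using Algebra.adjoin_induction with
    | mem z hz =>
      obtain rfl | rfl := hz
      · exact hx
      · exact hy
    | algebraMap r => simp [algebraMap_smul]
    | add b c _ _ hb hc => simp [add_smul, hb, hc]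
    | mul b c _ _ hb hc => simp [mul_smul, hb, hc]
  exact ⟨{ toFun := T, map_add' := T.map_add, map_smul' := H }, fun _ => rfl⟩

lemma exists_smul_eq_smul [IsAlgClosed k] (hA : Algebra.adjoin k {x, y} = ⊤)
    [IsSimpleModule A E] (hx : ∀ e : E, x • e = 0) : ∃ c : k, ∀ e : E, y • e = c • e := by
  let T : Module.End k E := Algebra.lsmul k k E y
  have hT (e : E) : T e = y • e := rfl
  suffices H : ∃ c : k, ¬ Function.Bijective ⇑(T - algebraMap k (Module.End k E) c) by
    obtain ⟨c, hc⟩ := H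
    have hs (e : E) : (T - algebraMap k (Module.End k E) c) e = y • e - c • e := rfl
    obtain ⟨g, hg⟩ := exists_linearMap_eq_of_commute hA (T - algebraMap k _ c)
      (fun e => by simp [hx]) (fun e => by
        rw [hs, hs, smul_sub, ← algebraMap_smul A c, ← algebraMap_smul A c e,
          smul_smul y (algebraMap k A c), smul_smul (algebraMap k A c) y, Algebra.commutes c y])
    refine ⟨c, fun e => ?_⟩
    rcases g.bijective_or_eq_zero with hb | rfl
    · exact absurd (by convert hb using 1; exact funext fun e => (hg e).symm) hc
    · have := hg e
      rw [hs, LinearMap.zero_apply] at this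
      exact sub_eq_zero.mp this.symm
  have hpoly (a : A) : ∃ p : k[X], ∀ e, a • e = aeval T p e := by
    have ha : a ∈ Algebra.adjoin k {x, y} := hA ▸ Algebra.mem_top
    induction ha using Algebra.adjoin_induction with
    | mem z hz =>
      obtain rfl | rfl := hz
      · exact ⟨0, by simpa using hx⟩
      · exact ⟨X, by simp [hT]⟩
    | algebraMap r => exact ⟨C r, by simp [algebraMap_smul, Module.algebraMap_end_apply]⟩
    | add b c _ _ hb hc =>
      obtain ⟨p, hp⟩ := hb
      obtain ⟨q, hq⟩ := hc
      exact ⟨p + q, by simp [add_smul, hp, hq]⟩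
    | mul b c _ _ hb hc =>
      obtain ⟨p, hp⟩ := hb
      obtain ⟨q, hq⟩ := hc
      exact ⟨p * q, by simp [mul_smul, hp, hq]⟩
  have := IsSimpleModule.nontrivial A E
  obtain ⟨s, hs⟩ := exists_ne (0 : E)
  by_cases h0 : y • s = 0
  · exact ⟨0, fun hb => hs (hb.1 (by simp [hT, h0]))⟩
  obtain ⟨a, ha⟩ := IsSimpleModule.toSpanSingleton_surjective A h0 s
  obtain ⟨p, hp⟩ := hpoly a
  have hq : aeval T (p * X - 1) s = 0 := by
    simp only [map_sub, map_mul, aeval_X, map_one, LinearMap.sub_apply, Module.End.mul_apply, hT,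
      ← hp, Module.End.one_apply]
    exact sub_eq_zero.mpr ha
  have hq0 : p * X - 1 ≠ 0 := fun h => by simpa using congrArg (coeff · 0) h
  rw [(IsAlgClosed.splits (p * X - 1)).eq_prod_roots, map_mul, aeval_C, Module.End.mul_apply,
    Module.algebraMap_end_apply, smul_eq_zero, leadingCoeff_eq_zero] at hq
  obtain ⟨c, hc, -⟩ := spectrum.exists_mem_of_not_isUnit_aeval_prod (a := T) (p := p * X - 1)
    fun hu => hs (((Module.End.isUnit_iff _).mp hu).1
      ((hq.resolve_left hq0).trans (map_zero _).symm))
  refine ⟨c, fun hb => hc ?_⟩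
  rw [spectrum.mem_resolventSet_iff, ← IsUnit.neg_iff, neg_sub]
  exact (Module.End.isUnit_iff _).mpr hb

/-- Over a ring generated by `x`, `y` with `y * x = x * y + x ^ 2`, a non-faithful module all of
whose nonzero endomorphisms are bijective has no simple proper submodule. -/
theorem surjective_of_simple_of_jordan [IsAlgClosed k] [CharZero k]
    (h : y * x = x * y + x ^ 2) (hA : Algebra.adjoin k {x, y} = ⊤)
    {a : A} (ha0 : a ≠ 0) (ha : ∀ e : E, a • e = 0)
    (hE : ∀ g : E →ₗ[A] E, g = 0 ∨ Function.Bijective g)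
    {S : Type*} [AddCommGroup S] [Module A S] [IsSimpleModule A S] (f : S →ₗ[A] E)
    (hf : Function.Injective f) : Function.Surjective f := by
  let := Module.compHom S (algebraMap k A)
  have : IsScalarTower k A S := ⟨fun c a s => by
    rw [Algebra.smul_def, mul_smul]; rfl⟩
  have := IsSimpleModule.nontrivial A S
  obtain ⟨s, hs⟩ := exists_ne (0 : S)
  have hfs : f s ≠ 0 := fun h0 => hs (hf (h0.trans f.map_zero.symm))
  have hx : ∀ e : E, x • e = 0 := by
    classical
    have hex : ∃ n : ℕ, ∀ e : E, x ^ n • e = 0 := by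
      obtain ⟨n, hn⟩ := exists_pow_mem h hA (Module.annihilator A E)
        (Module.mem_annihilator.mpr ha) ha0
      exact ⟨n, Module.mem_annihilator.mp hn⟩
    have hmin := fun m => Nat.find_min (m := m) hex
    have hn := Nat.find_spec hex
    generalize Nat.find hex = n at hn hmin
    rcases n with _ | _ | n
    · exact absurd (by simpa using hn (f s)) hfs
    · simpa using hn
    exfalso
    have hcomm : y * x ^ (n + 1) = x ^ (n + 1) * y + (n + 1 : k) • x ^ (n + 2) := by
      have := mul_aeval_of_jordan h (X ^ (n + 1) : k[X])
      rw [map_pow, aeval_X, derivative_X_pow] at this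
      rw [this, map_mul, aeval_C, Algebra.left_comm, Nat.add_sub_cancel, map_pow, aeval_X,
        ← pow_add, add_comm 2 n, Algebra.smul_def]
      simp
    obtain ⟨g, hg⟩ := exists_linearMap_eq_of_commute hA (Algebra.lsmul k k E (x ^ (n + 1)))
      (fun e => by simp only [Algebra.lsmul_coe, ← mul_smul, ← pow_succ, ← pow_succ'])
      (fun e => by
        simp only [Algebra.lsmul_coe, ← mul_smul]
        rw [hcomm, add_smul, smul_assoc, hn, smul_zero, add_zero])
    simp only [Algebra.lsmul_coe] at hg
    rcases hE g with rfl | hb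
    · exact hmin (n + 1) (by omega) fun e => (hg e).symm
    · refine hmin (n + 1) (by omega) fun e => hb.1 ?_
      rw [map_zero, hg, ← mul_smul, ← pow_add, show n + 1 + (n + 1) = n + (n + 1 + 1) by omega,
        pow_add, mul_smul, hn, smul_zero]
  obtain ⟨c, hc⟩ := exists_smul_eq_smul (k := k) (E := S) hA
    (fun t => hf (by rw [map_smul, hx, map_zero]))
  have hcS (t : S) : c • t = algebraMap k A c • t := rfl
  have hy : ∀ e : E, y • e = c • e := by
    obtain ⟨g, hg⟩ := exists_linearMap_eq_of_commute (E := E) hA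
      (Algebra.lsmul k k E (y - algebraMap k A c))
      (fun e => by simp only [hx, map_zero])
      (fun e => by
        simp only [Algebra.lsmul_coe, ← mul_smul]
        rw [sub_mul, mul_sub, Algebra.commutes])
    simp only [Algebra.lsmul_coe, sub_smul, algebraMap_smul] at hg
    rcases hE g with rfl | hb
    · exact fun e => sub_eq_zero.mp (hg e).symm
    · refine absurd (hb.1 ?_) hfs
      rw [map_zero, hg, ← algebraMap_smul A c, ← map_smul, ← map_smul, hc, hcS, sub_self]
  have hall (T : E →ₗ[k] E) : T = 0 ∨ Function.Injective T := by
    obtain ⟨g, hg⟩ := exists_linearMap_eq_of_commute hA T (by simp [hx]) (by simp [hy])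
    rcases hE g with rfl | hb
    · exact Or.inl (LinearMap.ext fun e => (hg e).symm)
    · exact Or.inr (by convert hb.1 using 1; exact funext fun e => (hg e).symm)
  by_contra hsurj
  have hlt : (LinearMap.range f).restrictScalars k < ⊤ := by
    rw [lt_top_iff_ne_top]
    intro htop
    refine hsurj (LinearMap.range_eq_top.mp ?_)
    simpa using htop
  obtain ⟨φ, hφ, hle⟩ := Submodule.exists_le_ker_of_lt_top _ hlt
  have hφs : φ (f s) = 0 := hle (show f s ∈ LinearMap.range f from ⟨s, rfl⟩)
  rcases hall (φ.smulRight (f s)) with h0 | hinj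
  · refine hφ (LinearMap.ext fun e => ?_)
    have := LinearMap.congr_fun h0 e
    simpa [hfs] using this
  · exact hfs (hinj (by simp [hφs]))

end Modules

section Category

open CategoryTheory

/-- An object `E` cogenerates some separator. In a module category this means that `E` is
faithful. -/
def CogeneratesSeparator {C : Type*} [Category C] (E : C) : Prop :=
  ∃ G : C, IsSeparator G ∧
    ∀ ⦃X : C⦄ (u v : X ⟶ G), (∀ h : G ⟶ E, u ≫ h = v ≫ h) → u = v

lemma CogeneratesSeparator.of_equivalence {C D : Type*} [Category C] [Category D] (e : C ≌ D)
    {E : D} (hE : CogeneratesSeparator (e.inverse.obj E)) : CogeneratesSeparator E := by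
  obtain ⟨G, hG, h⟩ := hE
  refine ⟨e.functor.obj G, hG.of_equivalence e, fun X u v huv => ?_⟩
  let adj := e.symm.toAdjunction
  obtain ⟨u, rfl⟩ := (adj.homEquiv _ _).surjective u
  obtain ⟨v, rfl⟩ := (adj.homEquiv _ _).surjective v
  congr 1
  refine h u v fun t => (adj.homEquiv _ _).injective ?_
  rw [adj.homEquiv_naturality_right, adj.homEquiv_naturality_right,
    ← cancel_mono (e.counit.app E)]
  simpa using huv (e.functor.map t ≫ e.counit.app E)

universe v

lemma cogeneratesSeparator_of_faithful {A : Type v} [Ring A] (E : ModuleCat.{v} A)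
    (hE : ∀ a : A, (∀ e : E, a • e = 0) → a = 0) : CogeneratesSeparator E := by
  refine ⟨ModuleCat.of A A, (isSeparator_def _).mpr fun X Y f g hfg => ?_, fun X u v huv => ?_⟩
  · ext m
    have := hfg (ModuleCat.ofHom (LinearMap.toSpanSingleton A X m))
    simpa using congr($this (1 : A))
  · ext m
    refine sub_eq_zero.mp (hE _ fun e => ?_)
    have := congr($(huv (ModuleCat.ofHom (LinearMap.toSpanSingleton A E e))) m)
    rw [sub_smul, sub_eq_zero]
    simpa using this

lemma eq_zero_of_cogeneratesSeparator {B : Type v} [Ring B] (E : ModuleCat.{v} B)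
    (hE : CogeneratesSeparator E) {z : B} (hz : ∀ e : E, z • e = 0) : z = 0 := by
  obtain ⟨G, hG, h⟩ := hE
  have hzG (w : G) : z • w = 0 := by
    have := h (ModuleCat.ofHom (LinearMap.toSpanSingleton B G (z • w))) 0 fun t => by
      ext
      simp [hz]
    simpa using congr($this (1 : B))
  let N : Submodule B B :=
    { carrier := {b | ∀ c : B, z * (c * b) = 0}
      add_mem' := fun ha hb c => by rw [mul_add, mul_add, ha, hb, add_zero]
      zero_mem' := by simp
      smul_mem' := fun a b hb c => by
        rw [smul_eq_mul, ← mul_assoc c]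
        exact hb _ }
  have hN := hG.def (X := ModuleCat.of B B) (ModuleCat.ofHom N.mkQ) 0 fun t => by
    ext w
    suffices t w ∈ N by simpa using this
    intro c
    rw [← smul_eq_mul c, ← map_smul, ← smul_eq_mul z, ← map_smul, hzG, map_zero]
  have h1 : (1 : B) ∈ N := by simpa using congr($hN (1 : B))
  simpa using h1 1

end Category

section Quotient

variable {k : Type u} [Field k]

lemma adjoin_mkAlgHom_eq_top (r : FA k → FA k → Prop) :
    Algebra.adjoin k {RingQuot.mkAlgHom k r (FreeAlgebra.ι k 0),
      RingQuot.mkAlgHom k r (FreeAlgebra.ι k 1)} = ⊤ := by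
  have h : Set.range (FreeAlgebra.ι k : Fin 2 → FA k) =
      {FreeAlgebra.ι k 0, FreeAlgebra.ι k 1} := by
    ext
    simp [Fin.exists_fin_two, eq_comm]
  rw [← Set.image_pair, ← AlgHom.map_adjoin, ← h, FreeAlgebra.adjoin_range_ι, Algebra.map_top,
    AlgHom.range_eq_top]
  exact RingQuot.mkAlgHom_surjective k r

/-- An algebra homomorphism out of `AQuot k f` is given by the images of the generators. -/
lemma exists_algHom_of_relation {R : Type*} [Ring R] [Algebra k R] (f : FA k) (a b : R)
    (h : FreeAlgebra.lift k ![a, b] f = 0) :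
    ∃ φ : AQuot k f →ₐ[k] R, φ (RingQuot.mkAlgHom k _ (FreeAlgebra.ι k 0)) = a ∧
      φ (RingQuot.mkAlgHom k _ (FreeAlgebra.ι k 1)) = b := by
  refine ⟨RingQuot.liftAlgHom k ⟨FreeAlgebra.lift k ![a, b], ?_⟩, ?_, ?_⟩
  · rintro _ _ ⟨rfl, rfl⟩
    rw [h, map_zero]
  · rw [RingQuot.liftAlgHom_mkAlgHom_apply]
    simp
  · rw [RingQuot.liftAlgHom_mkAlgHom_apply]
    simp

end Quotient

section Brick

variable {k : Type u} [Field k]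

open CategoryTheory

/-- If `x` acts on `k × k` as `(a, b) ↦ (b, 0)` and `y` as `(a, b) ↦ (0, b)`, the resulting module
has only scalar endomorphisms but has a simple proper submodule, and is killed by `x ^ 2`. -/
lemma exists_brick {B : Type u} [Ring B] [Algebra k B] {x y : B}
    (hE : ∃ φ : B →ₐ[k] Module.End k (k × k),
      φ x = LinearMap.inl k k k ∘ₗ LinearMap.snd k k k ∧
      φ y = LinearMap.inr k k k ∘ₗ LinearMap.snd k k k)
    (hB : Algebra.adjoin k {x, y} = ⊤) :
    ∃ (E S : ModuleCat.{u} B) (f : S ⟶ E), Simple S ∧ Mono f ∧ ¬ IsIso f ∧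
      (∀ g : E ⟶ E, g = 0 ∨ IsIso g) ∧ ∀ e : E, x ^ 2 • e = 0 := by
  obtain ⟨φ, hφx, hφy⟩ := hE
  let iE : Module B (k × k) := Module.compHom (k × k) φ.toRingHom
  have hE (b : B) (p : k × k) : b • p = φ b p := rfl
  have hx (p : k × k) : x • p = (p.2, 0) := by rw [hE, hφx]; rfl
  have hy (p : k × k) : y • p = (0, p.2) := by rw [hE, hφy]; rfl
  have hc (c : k) (p : k × k) : algebraMap k B c • p = c • p := by rw [hE, AlgHom.commutes]; rfl
  have hmem (b : B) : ∀ p : k × k, p.2 = 0 → (b • p).2 = 0 := by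
    have hb : b ∈ Algebra.adjoin k {x, y} := hB ▸ Algebra.mem_top
    induction hb using Algebra.adjoin_induction with
    | mem z hz =>
      intro p hp
      obtain rfl | rfl := hz
      · rw [hx]
      · rw [hy, hp]
    | algebraMap r =>
      intro p hp
      rw [hc, Prod.smul_snd, hp, smul_zero]
    | add b c _ _ hb hc =>
      intro p hp
      rw [add_smul, Prod.snd_add, hb p hp, hc p hp, add_zero]
    | mul b c _ _ hb hc =>
      intro p hp
      rw [mul_smul, hb _ (hc p hp)]
  let S : Submodule B (k × k) :=
    { carrier := {p | p.2 = 0}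
      add_mem' := fun {p q} (hp : p.2 = 0) (hq : q.2 = 0) => by
        rw [Set.mem_ofPred_eq, Prod.snd_add, hp, hq, add_zero]
      zero_mem' := rfl
      smul_mem' := fun b p hp => hmem b p hp }
  have hS (p : S) : (p : k × k).2 = 0 := p.2
  have hsimple : IsSimpleModule B S := by
    refine isSimpleModule_iff_toSpanSingleton_surjective.mpr
      ⟨⟨⟨⟨(1, 0), rfl⟩, 0, fun h => ?_⟩⟩, fun s hs t => ?_⟩
    · exact one_ne_zero (congrArg (fun p : S => (p : k × k).1) h)
    · have hs1 : (s : k × k).1 ≠ 0 := fun h => hs (Subtype.ext (Prod.ext h (hS s)))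
      refine ⟨algebraMap k B ((t : k × k).1 / (s : k × k).1), Subtype.ext ?_⟩
      rw [LinearMap.toSpanSingleton_apply, Submodule.coe_smul, hc]
      exact Prod.ext (div_mul_cancel₀ _ hs1) (by rw [Prod.smul_snd, hS s, hS t, smul_zero])
  refine ⟨ModuleCat.of B (k × k), ModuleCat.of B S, ModuleCat.ofHom S.subtype,
    simple_iff_isSimpleModule.mpr hsimple, ?_, ?_, ?_, ?_⟩
  · rw [ModuleCat.mono_iff_injective]
    exact S.injective_subtype
  · rw [ConcreteCategory.isIso_iff_bijective]
    intro hb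
    obtain ⟨s, hs⟩ := hb.2 ((0, 1) : k × k)
    exact zero_ne_one ((hS s).symm.trans (congrArg Prod.snd hs))
  · intro g
    have key (g : (k × k) →ₗ[B] (k × k)) : g = 0 ∨ Function.Bijective g := by
      have h1 : (g (0, 1)).1 = 0 := by
        have := congrArg Prod.fst (g.map_smul y (0, 1))
        simpa [hy] using this
      have hg (p : k × k) : g p = (g (0, 1)).2 • p := by
        have hp : p = (algebraMap k B p.1 * x + algebraMap k B p.2) • ((0, 1) : k × k) := by
          rw [add_smul, mul_smul, hx, hc, hc]
          ext <;> simp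
        conv_lhs => rw [hp]
        rw [map_smul, add_smul, mul_smul, hx, hc, hc]
        ext <;> simp [h1, mul_comm]
      by_cases h2 : (g (0, 1)).2 = 0
      · left
        ext1 p
        rw [hg, h2, zero_smul, LinearMap.zero_apply]
      · right
        have : ⇑g = fun p => (g (0, 1)).2 • p := funext hg
        rw [this]
        exact MulAction.bijective₀ h2
    rcases key g.hom with h | h
    · exact Or.inl (ModuleCat.hom_ext h)
    · exact Or.inr ((ConcreteCategory.isIso_iff_bijective g).mpr h)
  · intro e
    change x ^ 2 • (show k × k from e) = 0
    rw [sq, mul_smul, hx, hx]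
    rfl

/-- A ring generated by `x`, `y` with `y * x = x * y + x ^ 2` is not Morita equivalent to a ring
generated by `z`, `w` that acts on `k × k` as in `exists_brick` and in which `z ^ 2 ≠ 0`. -/
theorem not_isMorita_of_brick [IsAlgClosed k] [CharZero k] {A B : Type u} [Ring A] [Algebra k A]
    [Ring B] [Algebra k B] {x y : A} (hrel : y * x = x * y + x ^ 2)
    (hA : Algebra.adjoin k {x, y} = ⊤) {z w : B} (hB : Algebra.adjoin k {z, w} = ⊤)
    (hφ : ∃ φ : B →ₐ[k] Module.End k (k × k),
      φ z = LinearMap.inl k k k ∘ₗ LinearMap.snd k k k ∧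
      φ w = LinearMap.inr k k k ∘ₗ LinearMap.snd k k k)
    (hz : z ^ 2 ≠ 0) : ¬ IsMorita A B := by
  rintro ⟨e⟩
  obtain ⟨E, S, f, hS, hf, hfi, hE, hzE⟩ := exists_brick hφ hB
  have hnf : ¬ CogeneratesSeparator (e.inverse.obj E) := fun h =>
    hz (eq_zero_of_cogeneratesSeparator E (h.of_equivalence e) hzE)
  have hna := mt (cogeneratesSeparator_of_faithful _) hnf
  push Not at hna
  obtain ⟨a, ha, ha0⟩ := hna
  have hbrick (g : e.inverse.obj E ⟶ e.inverse.obj E) : g = 0 ∨ IsIso g := by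
    obtain ⟨g, rfl⟩ := e.inverse.map_surjective g
    rcases hE g with rfl | hg
    · exact Or.inl (e.inverse.map_zero _ _)
    · exact Or.inr inferInstance
  have hS' : Simple (e.inverse.obj S) := simple_obj _ _
  let := Module.compHom (e.inverse.obj E) (algebraMap k A)
  have : IsScalarTower k A (e.inverse.obj E) := ⟨fun c a s => by
    rw [Algebra.smul_def, mul_smul]; rfl⟩
  have hinj := (ModuleCat.mono_iff_injective (e.inverse.map f)).mp inferInstance
  have hsurj := surjective_of_simple_of_jordan hrel hA ha0 ha
    (fun g => (hbrick (ModuleCat.ofHom g)).imp (fun h => congrArg ModuleCat.Hom.hom h)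
      fun h => (ConcreteCategory.isIso_iff_bijective _).mp h)
    (e.inverse.map f).hom hinj
  have hiso : IsIso (e.inverse.map f) :=
    (ConcreteCategory.isIso_iff_bijective _).mpr ⟨hinj, hsurj⟩
  exact hfi (isIso_of_reflects_iso f e.inverse)

end Brick

/-- Over an algebraically closed field of characteristic zero, the Jordan plane
`k⟨x,y⟩/(xy−yx+x²)` is not Morita equivalent to `k⟨x,y⟩/(xy−yx+x²−x)`. -/
theorem statement3 (k : Type u) [Field k] [IsAlgClosed k] [CharZero k] :
    ¬ IsMorita
      (AQuot k (FreeAlgebra.ι k (0 : Fin 2) * FreeAlgebra.ι k (1 : Fin 2) -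
        FreeAlgebra.ι k (1 : Fin 2) * FreeAlgebra.ι k (0 : Fin 2) +
        FreeAlgebra.ι k (0 : Fin 2) ^ 2))
      (AQuot k (FreeAlgebra.ι k (0 : Fin 2) * FreeAlgebra.ι k (1 : Fin 2) -
        FreeAlgebra.ι k (1 : Fin 2) * FreeAlgebra.ι k (0 : Fin 2) +
        FreeAlgebra.ι k (0 : Fin 2) ^ 2 - FreeAlgebra.ι k (0 : Fin 2))) := by
  refine not_isMorita_of_brick ?_ (adjoin_mkAlgHom_eq_top _) (adjoin_mkAlgHom_eq_top _)
    (exists_algHom_of_relation _ _ _ (by ext <;> simp [sq])) fun h => ?_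
  · have hrel := RingQuot.mkAlgHom_rel k (s := fun a b : FA k =>
      a = (FreeAlgebra.ι k (0 : Fin 2) * FreeAlgebra.ι k (1 : Fin 2) -
        FreeAlgebra.ι k (1 : Fin 2) * FreeAlgebra.ι k (0 : Fin 2) +
        FreeAlgebra.ι k (0 : Fin 2) ^ 2) ∧ b = 0) ⟨rfl, rfl⟩
    rw [map_add, map_sub, map_mul, map_mul, map_pow, map_zero] at hrel
    rw [← sub_eq_zero, ← neg_eq_zero, ← hrel]
    abel
  · obtain ⟨χ, hχ, -⟩ := exists_algHom_of_relation (k := k) (R := k)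
      (FreeAlgebra.ι k (0 : Fin 2) * FreeAlgebra.ι k (1 : Fin 2) -
        FreeAlgebra.ι k (1 : Fin 2) * FreeAlgebra.ι k (0 : Fin 2) +
        FreeAlgebra.ι k (0 : Fin 2) ^ 2 - FreeAlgebra.ι k (0 : Fin 2)) 1 0 (by simp)
    simpa [hχ] using congrArg χ h
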